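/- Let H be a complex Hilbert space, c > 0, and π : (c,∞) → B(H) a map such that: π(s+t) = π(s)π(t) for all s,t > c with s+t > c (i.e. for all s,t > c); each π(t) is selfadjoint; π is locally bounded (every point of (c,∞) has a neighborhood on which ‖π(·)‖ is bounded); and π is non-degenerate, i.e. span{π(t)v : t > c, v ∈ H} is dense in H. Then there exists a unique map π̃ : [0,∞) → B(H) with π̃(t) = π(t) for t > c, π̃(s+t) = π̃(s)π̃(t) for all s,t ≥ 0, each π̃(t) selfadjoint, and π̃(0) = id_H. Moreover, t ↦ π̃(t)v is continuous on (0,∞) for every v ∈ H, the map π̃ is real-analytic on (0,∞) as a B(H)-valued map, and for every t ≥ 0 the range of π̃(t) is dense in H. -/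

import Mathlib

open Filter Topology

section aux
variable {A : Type*} [CStarAlgebra A] [PartialOrder A] [StarOrderedRing A]

theorem aux_pow_le (X Y : A) (hX : 0 ≤ X) (hY : 0 ≤ Y) (n : ℕ) (hn : n ≠ 0)
    (h : X ^ n ≤ Y ^ n) : X ≤ Y := by
  have h1 : ∀ Z : A, 0 ≤ Z → (Z ^ n) ^ (n:ℝ)⁻¹ = Z := by
    intro Z hZ
    rw [← CFC.rpow_natCast Z n, CFC.rpow_rpow_of_exponent_nonneg Z _ _ (by positivity) (by positivity) hZ,
      mul_inv_cancel₀ (by exact_mod_cast hn), CFC.rpow_one Z]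
  have := CFC.rpow_le_rpow (p := (n:ℝ)⁻¹) ⟨by positivity, inv_le_one_of_one_le₀ (by exact_mod_cast Nat.one_le_iff_ne_zero.mpr hn)⟩ h
  rwa [h1 X hX, h1 Y hY] at this

theorem aux_scalar (x ε δ : ℝ) (hx : 0 ≤ x) (hε : 0 < ε) (hε1 : ε < 1) (hδ : 0 < δ) (z : ℂ)
    (hz : δ < z.re) : ‖(x:ℂ) ^ z - ((max x ε : ℝ) : ℂ) ^ z‖ ≤ 2 * ε ^ δ := by
  rcases le_or_gt ε x with h | h
  · rw [max_eq_left h]; simp; positivity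
  · rw [max_eq_right h.le]
    refine (norm_sub_le _ _).trans ?_
    rw [Complex.norm_cpow_eq_rpow_re_of_nonneg hx (by linarith),
      Complex.norm_cpow_eq_rpow_re_of_nonneg hε.le (by linarith)]
    have h1 : x ^ z.re ≤ ε ^ z.re := Real.rpow_le_rpow hx h.le (by linarith)
    have h2 : ε ^ z.re ≤ ε ^ δ := Real.rpow_le_rpow_of_exponent_ge hε hε1.le hz.le
    linarith

theorem aux_spec (P : A) (hP : 0 ≤ P) (w : ℂ) (hw : w ∈ spectrum ℂ P) : 0 ≤ w.re ∧ (w.re : ℂ) = w := by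
  have hs : IsSelfAdjoint P := .of_nonneg hP
  have h2 := hs.mem_spectrum_eq_re hw
  refine ⟨?_, h2.symm⟩
  apply spectrum_nonneg_of_nonneg hP
  rw [h2] at hw
  exact (spectrum.algebraMap_mem_iff ℂ).mp hw

theorem aux_family (P : A) (hP : 0 ≤ P) : ∃ F : ℂ → A,
    DifferentiableOn ℂ F {z | 0 < z.re} ∧
    (∀ z w : ℂ, 0 < z.re → 0 < w.re → F (z + w) = F z * F w) ∧
    F 1 = P ∧ ∀ t : ℝ, 0 < t → IsSelfAdjoint (F t) := by
  have hs : IsSelfAdjoint P := .of_nonneg hP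
  have hn : IsStarNormal P := hs.isStarNormal
  have hcont : ∀ z : ℂ, 0 < z.re → Continuous (fun w : ℂ => ((w.re : ℝ) : ℂ) ^ z) := fun z hz =>
    (Complex.continuous_ofReal_cpow_const hz).comp Complex.continuous_re
  refine ⟨fun z => cfc (fun w : ℂ => ((w.re : ℝ) : ℂ) ^ z) P, ?_, ?_, ?_, ?_⟩
  · refine TendstoLocallyUniformlyOn.differentiableOn (φ := 𝓝[>] (0:ℝ))
      (F := fun ε z => cfc (fun w : ℂ => ((max w.re ε : ℝ) : ℂ) ^ z) P) ?_ ?_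
      (isOpen_lt continuous_const Complex.continuous_re)
    · rw [Metric.tendstoLocallyUniformlyOn_iff]
      intro η hη z0 (hz0 : 0 < z0.re)
      refine ⟨{z | z0.re / 2 < z.re}, mem_nhdsWithin_of_mem_nhds
        ((isOpen_lt continuous_const Complex.continuous_re).mem_nhds
          (by show z0.re / 2 < z0.re; linarith)), ?_⟩
      have hT : Tendsto (fun ε : ℝ => 2 * ε ^ (z0.re / 2)) (𝓝[>] (0:ℝ)) (𝓝 0) := by
        have : ContinuousAt (fun ε : ℝ => 2 * ε ^ (z0.re / 2)) 0 :=
          continuousAt_const.mul (Real.continuousAt_rpow_const _ _ (Or.inr (by linarith)))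
        have h0 := this.tendsto
        rw [Real.zero_rpow (by linarith), mul_zero] at h0
        exact h0.mono_left nhdsWithin_le_nhds
      filter_upwards [hT.eventually (gt_mem_nhds hη), self_mem_nhdsWithin,
        nhdsWithin_le_nhds (gt_mem_nhds (zero_lt_one))] with ε h1 h2 h3 z hz
      have h2 : 0 < ε := h2
      have hz : z0.re / 2 < z.re := hz
      have h3 : ε < 1 := h3
      have hcc : Continuous (fun w : ℂ => ((max w.re ε : ℝ) : ℂ) ^ z) :=
        (Complex.continuous_ofReal_cpow_const (by linarith)).comp
          (Complex.continuous_re.max continuous_const)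
      rw [dist_eq_norm, ← cfc_sub _ _ P (hcont z (by linarith)).continuousOn
        hcc.continuousOn]
      · refine lt_of_le_of_lt (norm_cfc_le (by positivity) ?_) h1
        intro w hw
        exact aux_scalar _ _ _ (aux_spec P hP w hw).1 h2 h3 (by linarith) z hz
    · filter_upwards [self_mem_nhdsWithin] with ε hε
      have hε : 0 < ε := hε
      have hl : Continuous (fun w : ℂ => ((Real.log (max w.re ε) : ℝ) : ℂ)) :=
        Complex.continuous_ofReal.comp ((Complex.continuous_re.max continuous_const).log
          (fun w => (lt_of_lt_of_le hε (le_max_right _ _)).ne'))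
      have : (fun z => cfc (fun w : ℂ => ((max w.re ε : ℝ) : ℂ) ^ z) P) =
          fun z : ℂ => NormedSpace.exp (z • cfc (fun w : ℂ => ((Real.log (max w.re ε) : ℝ) : ℂ)) P) := by
        funext z
        have hzl : Continuous (fun w : ℂ => z • ((Real.log (max w.re ε) : ℝ) : ℂ)) := hl.const_smul z
        rw [← cfc_smul z _ P hl.continuousOn, ← CFC.exp_eq_normedSpace_exp (𝕜 := ℂ) (cfc_predicate _ _),
          ← cfc_comp' NormedSpace.exp _ P (NormedSpace.exp_continuous.continuousOn) hzl.continuousOn]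
        congr 1
        funext w
        have hm : 0 < max w.re ε := lt_of_lt_of_le hε (le_max_right _ _)
        rw [Complex.cpow_def_of_ne_zero (by exact_mod_cast hm.ne'), ← Complex.exp_eq_exp_ℂ,
          Complex.ofReal_log hm.le, smul_eq_mul, mul_comm]
      rw [this]
      exact fun z _ => (hasDerivAt_exp_smul_const _ z).differentiableAt.differentiableWithinAt
  · intro z w hz hw
    show cfc _ P = cfc _ P * cfc _ P
    rw [← cfc_mul _ _ P (hcont z hz).continuousOn (hcont w hw).continuousOn]
    congr 1
    funext x
    by_cases hx : ((x.re : ℝ) : ℂ) = 0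
    · have h1 : z ≠ 0 := by rintro rfl; simp at hz
      have h2 : z + w ≠ 0 := by
        intro h; have := congrArg Complex.re h; simp at this; linarith
      rw [hx, Complex.zero_cpow h1, Complex.zero_cpow h2, zero_mul]
    · exact Complex.cpow_add _ _ hx
  · show cfc _ P = P
    conv_rhs => rw [← cfc_id ℂ P]
    apply cfc_congr
    intro w hw
    simpa using (aux_spec P hP w hw).2
  · intro t ht
    show star (cfc _ P) = cfc _ P
    rw [← cfc_star]
    apply cfc_congr
    intro w hw
    have h0 := (aux_spec P hP w hw).1
    show star (((w.re : ℝ) : ℂ) ^ (t:ℂ)) = ((w.re : ℝ) : ℂ) ^ (t:ℂ)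
    rw [← Complex.ofReal_cpow h0]
    exact Complex.conj_ofReal _


theorem aux_mulpow (c : ℝ) (hc : 0 ≤ c) (π : ℝ → A)
    (hmul : ∀ s > c, ∀ t > c, π (s + t) = π s * π t) (t : ℝ) (ht : c < t) (n : ℕ) :
    π ((n + 1 : ℕ) * t) = π t ^ (n + 1) := by
  induction n with
  | zero => simp
  | succ n ih =>
    rw [pow_succ, ← ih, ← hmul _ _ _ ht]
    · congr 1; push_cast; ring
    · push_cast
      nlinarith [mul_nonneg (Nat.cast_nonneg (α := ℝ) n) (hc.trans ht.le)]

theorem aux_nonneg (c : ℝ) (π : ℝ → A)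
    (hmul : ∀ s > c, ∀ t > c, π (s + t) = π s * π t)
    (hsa : ∀ t > c, IsSelfAdjoint (π t)) (t : ℝ) (ht : 2 * c < t) : 0 ≤ π t := by
  have h : c < t / 2 := by linarith
  have h1 := hmul _ h _ h
  rw [add_halves] at h1
  rw [h1]
  have := star_mul_self_nonneg (π (t / 2))
  rwa [(hsa _ h).star_eq] at this

theorem aux_compare (c : ℝ) (hc : 0 < c) (π ρ : ℝ → A)
    (hmul : ∀ s > c, ∀ t > c, π (s + t) = π s * π t)
    (hsa : ∀ t > c, IsSelfAdjoint (π t))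
    (C : ℝ) (hC0 : 0 < C) (hC : ∀ u ∈ Set.Icc (4 * c) (8 * c), ‖π u‖ ≤ C)
    (rmul : ∀ s > 0, ∀ t > 0, ρ (s + t) = ρ s * ρ t)
    (rsa : ∀ t > 0, IsSelfAdjoint (ρ t))
    (rcont : ContinuousOn ρ (Set.Ioi 0)) (hρ : ρ (4 * c) = π (4 * c))
    (t : ℝ) (ht : 2 * c < t) : π t = ρ t := by
  have ppos := aux_nonneg c π hmul hsa
  have rpos := aux_nonneg 0 ρ rmul rsa
  simp only [mul_zero] at rpos
  have ppow := aux_mulpow c hc.le π hmul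
  have rpow := aux_mulpow 0 le_rfl ρ rmul
  have ppow' : ∀ t > c, ∀ n : ℕ, n ≠ 0 → π (n * t) = π t ^ n := by
    intro t ht n hn
    obtain ⟨k, rfl⟩ := Nat.exists_eq_succ_of_ne_zero hn
    exact ppow t ht k
  have rpow' : ∀ t > 0, ∀ n : ℕ, n ≠ 0 → ρ (n * t) = ρ t ^ n := by
    intro t ht n hn
    obtain ⟨k, rfl⟩ := Nat.exists_eq_succ_of_ne_zero hn
    exact rpow t ht k
  have hle : ∀ u ∈ Set.Icc (4 * c) (8 * c), π u ≤ algebraMap ℝ A C := fun u hu =>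
    (CStarAlgebra.norm_le_iff_le_algebraMap (π u) hC0.le
      (ppos u (by linarith [hu.1]))).mp (hC u hu)
  have conj : ∀ r > c, ∀ u ∈ Set.Icc (4 * c) (8 * c), π (r + u + r) ≤ C • π (r + r) := by
    intro r hr u hu
    rw [hmul (r + u) (by linarith [hu.1]) r hr, hmul r hr u (by linarith [hu.1]), hmul r hr r hr]
    have := (hsa r hr).conjugate_le_conjugate (hle u hu)
    rwa [Algebra.algebraMap_eq_smul_one, mul_smul_comm, mul_one, smul_mul_assoc] at this
  have rp : ∀ m : ℕ, m ≠ 0 → ∀ n : ℕ, n ≠ 0 → π (4 * c * m) = ρ (4 * c * m / n) ^ n := by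
    intro m hm n hn
    have hm' : (0:ℝ) < m := by exact_mod_cast Nat.pos_of_ne_zero hm
    have hn' : (0:ℝ) < n := by exact_mod_cast Nat.pos_of_ne_zero hn
    rw [← rpow' _ (by positivity) n hn, mul_div_cancel₀ _ hn'.ne', mul_comm, ppow' _ (by linarith) m hm,
      rpow' _ (by positivity) m hm, hρ]
  have root : ∀ n : ℕ, n ≠ 0 → (C ^ ((n:ℝ)⁻¹)) ^ n = C := fun n hn =>
    Real.rpow_inv_natCast_pow hC0.le hn
  have rootpos : ∀ n : ℕ, 0 ≤ C ^ ((n:ℝ)⁻¹) := fun n => by positivity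
  have rootlim : Tendsto (fun n : ℕ => C ^ ((n:ℝ)⁻¹)) atTop (𝓝 1) := by
    have h1 : Tendsto (fun n : ℕ => ((n:ℝ)⁻¹)) atTop (𝓝 0) := tendsto_inv_atTop_nhds_zero_nat
    have := (Real.continuousAt_const_rpow (a := C) (b := 0) hC0.ne').tendsto.comp h1
    rw [Real.rpow_zero] at this
    exact this
  have ht0 : 0 < t := by linarith
  have big : ∀ᶠ n : ℕ in atTop, 12 * c ≤ n * t ∧ n ≠ 0 := by
    have : Tendsto (fun n : ℕ => (n:ℝ) * t) atTop atTop :=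
      tendsto_natCast_atTop_atTop.atTop_mul_const ht0
    exact (this.eventually_ge_atTop _).and (eventually_ne_atTop 0)
  have rlim : ∀ m : ℕ → ℕ, (∀ᶠ n : ℕ in atTop, |4 * c * m n - n * t| ≤ 8 * c) →
      Tendsto (fun n : ℕ => ρ (4 * c * m n / n)) atTop (𝓝 (ρ t)) := by
    intro m hm
    have h1 : Tendsto (fun n : ℕ => 4 * c * m n / n) atTop (𝓝 t) := by
      rw [tendsto_iff_dist_tendsto_zero]
      refine squeeze_zero' (g := fun n : ℕ => 8 * c / n) (Eventually.of_forall fun n => dist_nonneg) ?_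
        (tendsto_const_div_atTop_nhds_zero_nat _)
      filter_upwards [hm, eventually_ne_atTop 0] with n h h0
      have hn' : (0:ℝ) < n := by exact_mod_cast Nat.pos_of_ne_zero h0
      rw [Real.dist_eq, show 4 * c * m n / n - t = (4 * c * m n - n * t) / n by field_simp, abs_div,
        abs_of_pos hn']
      gcongr
    exact (rcont.continuousAt (Ioi_mem_nhds ht0)).tendsto.comp h1
  have fl : ∀ n : ℕ, 4 * c * ⌊n * t / (4 * c)⌋₊ ≤ n * t ∧ n * t ≤ 4 * c * (⌊n * t / (4 * c)⌋₊ + 1) := by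
    intro n
    have h1 := Nat.floor_le (show 0 ≤ n * t / (4 * c) by positivity)
    have h2 := (Nat.lt_floor_add_one (n * t / (4 * c))).le
    rw [le_div_iff₀ (by positivity)] at h1
    rw [div_le_iff₀ (by positivity)] at h2
    constructor <;> linarith
  apply le_antisymm
  · have hlim := rootlim.smul (rlim (fun n => ⌊n * t / (4 * c)⌋₊ - 1) ?_)
    · rw [one_smul] at hlim
      refine ge_of_tendsto hlim ?_
      filter_upwards [big] with n hn
      obtain ⟨f1, f2⟩ := fl n
      set k := ⌊n * t / (4 * c)⌋₊
      have hk : 2 ≤ k := by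
        have : (2:ℝ) ≤ k := by nlinarith [hn.1]
        exact_mod_cast this
      obtain ⟨m, hm⟩ : ∃ m, k = m + 1 := ⟨k - 1, by omega⟩
      rw [hm] at f1 f2 ⊢
      have hm0 : m ≠ 0 := by omega
      have hm1 : (1:ℝ) ≤ m := by exact_mod_cast Nat.one_le_iff_ne_zero.mpr hm0
      push_cast at f1 f2
      refine aux_pow_le _ _ (ppos t ht) (smul_nonneg (rootpos n) (rpos _ ?_)) n hn.2 ?_
      · have : (0:ℝ) < n := by exact_mod_cast Nat.pos_of_ne_zero hn.2
        simp only [Nat.add_sub_cancel]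
        positivity
      · rw [smul_pow, root n hn.2, Nat.add_sub_cancel, ← rp m hm0 n hn.2, ← ppow' t (by linarith) n hn.2]
        have := conj (2 * c * m) (by nlinarith) (n * t - 4 * c * m) ⟨by linarith, by linarith⟩
        convert this using 2 <;> [skip; congr 1] <;> ring
    · filter_upwards [big] with n hn
      obtain ⟨f1, f2⟩ := fl n
      set k := ⌊n * t / (4 * c)⌋₊
      have hk : 2 ≤ k := by
        have : (2:ℝ) ≤ k := by nlinarith [hn.1]
        exact_mod_cast this
      rw [Nat.cast_sub (by omega), abs_le]
      push_cast
      constructor <;> linarith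
  · have hlim := rlim (fun n => ⌊n * t / (4 * c)⌋₊ + 2) ?_
    · have hlim2 : Tendsto (fun n : ℕ => C ^ ((n:ℝ)⁻¹) • π t) atTop (𝓝 (π t)) := by
        simpa using rootlim.smul_const (π t)
      refine le_of_tendsto_of_tendsto hlim hlim2 ?_
      filter_upwards [big] with n hn
      obtain ⟨f1, f2⟩ := fl n
      set k := ⌊n * t / (4 * c)⌋₊
      have hn' : (1:ℝ) ≤ n := by exact_mod_cast Nat.one_le_iff_ne_zero.mpr hn.2
      refine aux_pow_le _ _ (rpos _ ?_) (smul_nonneg (rootpos n) (ppos t ht)) n hn.2 ?_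
      · push_cast; positivity
      · rw [smul_pow, root n hn.2, ← rp (k + 2) (by omega) n hn.2, ← ppow' t (by linarith) n hn.2]
        have := conj (n * t / 2) (by nlinarith) (4 * c * (k + 2) - n * t) ⟨by linarith, by linarith⟩
        push_cast
        convert this using 2 <;> [skip; congr 1] <;> ring
    · filter_upwards with n
      obtain ⟨f1, f2⟩ := fl n
      rw [abs_le]
      push_cast
      constructor <;> linarith

end aux

section hil
variable {H : Type*} [NormedAddCommGroup H] [InnerProductSpace ℂ H] [CompleteSpace H]

theorem aux_inj (c : ℝ) (hc : 0 < c) (π : ℝ → H →L[ℂ] H)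
    (hmul : ∀ s > c, ∀ t > c, π (s + t) = π s ∘L π t)
    (hsa : ∀ t > c, IsSelfAdjoint (π t))
    (hnd : Dense (↑(Submodule.span ℂ
      {w : H | ∃ t > c, ∃ v : H, w = (π t) v}) : Set H))
    (t : ℝ) (ht : c < t) (v : H) (hv : π t v = 0) : v = 0 := by
  have sym : ∀ s > c, ∀ x y : H, inner ℂ (π s x) y = inner ℂ x (π s y) := fun s hs x y =>
    (ContinuousLinearMap.isSelfAdjoint_iff_isSymmetric.mp (hsa s hs)) x y
  have half : ∀ s > c, π (s + s) v = 0 → π s v = 0 := by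
    intro s hs h
    rw [hmul s hs s hs] at h
    rw [← inner_self_eq_zero (𝕜 := ℂ), sym s hs]
    have h' : π s (π s v) = 0 := h
    rw [h', inner_zero_right]
  have it : ∀ k : ℕ, ∀ s > c, π (2 ^ k * s) v = 0 → π s v = 0 := by
    intro k
    induction k with
    | zero => intro s _ h; simpa using h
    | succ k ih =>
      intro s hs h
      refine half s hs (ih (s + s) (by linarith) ?_)
      rw [← h]; congr 2; ring
  have all : ∀ s > c, π s v = 0 := by
    intro s hs
    have hs0 : 0 < s := hc.trans hs
    obtain ⟨k, hk⟩ := pow_unbounded_of_one_lt ((t + c) / s) (one_lt_two (α := ℝ))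
    rw [div_lt_iff₀ hs0] at hk
    apply it k s hs
    rw [show 2 ^ k * s = (2 ^ k * s - t) + t by ring, hmul _ (by linarith) t ht]
    simp [hv]
  suffices key : ∀ w ∈ Submodule.span ℂ {w : H | ∃ t > c, ∃ v : H, w = (π t) v}, inner ℂ v w = 0 by
    exact hnd.eq_zero_of_inner_left ℂ (fun w hw => key w hw)
  intro w hw
  induction hw using Submodule.span_induction with
  | mem x h =>
    obtain ⟨s, hs, u, rfl⟩ := h
    rw [← sym s hs, all s hs, inner_zero_left]
  | zero => simp
  | add x y _ _ hx hy => rw [inner_add_right, hx, hy, add_zero]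
  | smul a x _ hx => rw [inner_smul_right, hx, mul_zero]

theorem aux_dense (T : H →L[ℂ] H) (hT : IsSelfAdjoint T) (hi : ∀ v, T v = 0 → v = 0) :
    DenseRange T := by
  have h : (LinearMap.range (T : H →ₗ[ℂ] H))ᗮ = ⊥ := by
    rw [Submodule.eq_bot_iff]
    intro v hv
    apply hi
    rw [← inner_self_eq_zero (𝕜 := ℂ)]
    refine ((ContinuousLinearMap.isSelfAdjoint_iff_isSymmetric.mp hT) v (T v)).trans ?_
    rw [Submodule.mem_orthogonal'] at hv
    exact hv _ ⟨T v, rfl⟩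
  rw [← Submodule.topologicalClosure_eq_top_iff, ← Submodule.dense_iff_topologicalClosure_eq_top] at h
  exact h

end hil

theorem stmt_10 {H : Type*} [NormedAddCommGroup H] [InnerProductSpace ℂ H] [CompleteSpace H]
    (c : ℝ) (hc : 0 < c) (π : ℝ → H →L[ℂ] H)
    (hmul : ∀ s > c, ∀ t > c, π (s + t) = π s ∘L π t)
    (hsa : ∀ t > c, IsSelfAdjoint (π t))
    (hloc : ∀ t > c, ∃ V ∈ nhdsWithin t (Set.Ioi c), ∃ C : ℝ, ∀ u ∈ V, ‖π u‖ ≤ C)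
    (hnd : Dense (↑(Submodule.span ℂ
      {w : H | ∃ t > c, ∃ v : H, w = (π t) v}) : Set H)) :
    ∃ ρ : ℝ → H →L[ℂ] H,
      ((∀ t > c, ρ t = π t) ∧
       (∀ s ≥ (0:ℝ), ∀ t ≥ (0:ℝ), ρ (s + t) = ρ s ∘L ρ t) ∧
       (∀ t ≥ (0:ℝ), IsSelfAdjoint (ρ t)) ∧
       ρ 0 = ContinuousLinearMap.id ℂ H) ∧
      (∀ ρ' : ℝ → H →L[ℂ] H,
        ((∀ t > c, ρ' t = π t) ∧
         (∀ s ≥ (0:ℝ), ∀ t ≥ (0:ℝ), ρ' (s + t) = ρ' s ∘L ρ' t) ∧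
         (∀ t ≥ (0:ℝ), IsSelfAdjoint (ρ' t)) ∧
         ρ' 0 = ContinuousLinearMap.id ℂ H) →
        ∀ t ≥ (0:ℝ), ρ' t = ρ t) ∧
      (∀ v : H, ContinuousOn (fun t => (ρ t) v) (Set.Ioi (0:ℝ))) ∧
      AnalyticOnNhd ℝ ρ (Set.Ioi (0:ℝ)) ∧
      (∀ t ≥ (0:ℝ), DenseRange ⇑(ρ t)) := by
  have pdense : ∀ t > c, DenseRange (π t) := fun t ht =>
    aux_dense _ (hsa t ht) (aux_inj c hc π hmul hsa hnd t ht)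
  have cancel : ∀ t > c, ∀ S T : H →L[ℂ] H, S ∘L π t = T ∘L π t → S = T := by
    intro t ht S T h
    ext1 x
    refine congrFun ((pdense t ht).equalizer S.continuous T.continuous ?_) x
    funext y
    exact DFunLike.congr_fun h y
  obtain ⟨C, hC0, hC⟩ : ∃ C : ℝ, 0 < C ∧ ∀ u ∈ Set.Icc (4 * c) (8 * c), ‖π u‖ ≤ C := by
    have : ∃ C : ℝ, ∀ u ∈ Set.Icc (4 * c) (8 * c), ‖π u‖ ≤ C := by
      refine (isCompact_Icc (a := 4 * c) (b := 8 * c)).induction_on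
        (p := fun s => ∃ C : ℝ, ∀ u ∈ s, ‖π u‖ ≤ C) ⟨0, by simp⟩ ?_ ?_ ?_
      · rintro s t hst ⟨C, h⟩
        exact ⟨C, fun u hu => h u (hst hu)⟩
      · rintro s t ⟨C, h⟩ ⟨D, h'⟩
        refine ⟨max C D, ?_⟩
        rintro u (hu | hu)
        · exact (h u hu).trans (le_max_left _ _)
        · exact (h' u hu).trans (le_max_right _ _)
      · intro x hx
        have hx' : c < x := by linarith [hx.1]
        obtain ⟨V, hV, D, hD⟩ := hloc x hx'
        rw [nhdsWithin_eq_nhds.mpr (Ioi_mem_nhds hx')] at hV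
        exact ⟨V, mem_nhdsWithin_of_mem_nhds hV, D, hD⟩
    obtain ⟨C, h⟩ := this
    exact ⟨max C 1, by positivity, fun u hu => (h u hu).trans (le_max_left _ _)⟩
  obtain ⟨F, Fd, Fmul, F1, Fsa⟩ := aux_family (π (4 * c))
    (aux_nonneg c π hmul hsa (4 * c) (by linarith))
  have Fan : AnalyticOnNhd ℂ F {z | 0 < z.re} :=
    Fd.analyticOnNhd (isOpen_lt continuous_const Complex.continuous_re)
  set σ : ℝ → H →L[ℂ] H := fun t => F ((t / (4 * c) : ℝ) : ℂ) with hσ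
  have re_pos : ∀ t : ℝ, 0 < t → 0 < (((t / (4 * c) : ℝ) : ℂ)).re := by
    intro t ht
    rw [Complex.ofReal_re]; positivity
  have smul' : ∀ s > 0, ∀ t > 0, σ (s + t) = σ s * σ t := by
    intro s hs t ht
    rw [hσ]
    simp only
    rw [← Fmul _ _ (re_pos s hs) (re_pos t ht), ← Complex.ofReal_add, add_div]
  have ssa : ∀ t > 0, IsSelfAdjoint (σ t) := fun t ht => Fsa _ (by positivity)
  have san : AnalyticOnNhd ℝ σ (Set.Ioi 0) := by
    intro t ht
    have h1 : AnalyticAt ℝ F ((t / (4 * c) : ℝ) : ℂ) := (Fan _ (re_pos t ht)).restrictScalars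
    have h2 : AnalyticAt ℝ (fun t : ℝ => ((t / (4 * c) : ℝ) : ℂ)) t := by
      have h3 : AnalyticAt ℝ (fun t : ℝ => t / (4 * c)) t := by
        simp only [div_eq_mul_inv]
        fun_prop
      exact (Complex.ofRealCLM.analyticAt _).comp h3
    exact AnalyticAt.comp' (f := fun t : ℝ => ((t / (4 * c) : ℝ) : ℂ)) h1 h2
  have s4 : σ (4 * c) = π (4 * c) := by
    rw [hσ]; simp only
    rw [div_self (by positivity), Complex.ofReal_one, F1]
  have big : ∀ t, 2 * c < t → π t = σ t := fun t ht =>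
    aux_compare c hc π σ hmul hsa C hC0 hC smul' ssa san.continuousOn s4 t ht
  have eqc : ∀ t > c, σ t = π t := by
    intro t ht
    refine cancel (4 * c) (by linarith) _ _ ?_
    rw [← hmul t ht (4 * c) (by linarith), ← s4, big _ (by linarith)]
    exact (smul' t (by linarith) (4 * c) (by linarith)).symm
  set ρ : ℝ → H →L[ℂ] H := fun t => if t = 0 then 1 else σ t with hρ
  have ρ0 : ρ 0 = 1 := by simp [hρ]
  have ρs : ∀ t > 0, ρ t = σ t := fun t ht => by simp [hρ, ht.ne']
  have ρc : ∀ t > c, ρ t = π t := fun t ht => by rw [ρs t (hc.trans ht), eqc t ht]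
  have ρmul : ∀ s ≥ (0:ℝ), ∀ t ≥ (0:ℝ), ρ (s + t) = ρ s ∘L ρ t := by
    intro s hs t ht
    rcases hs.eq_or_lt with rfl | hs
    · rw [ρ0, zero_add]; rfl
    rcases ht.eq_or_lt with rfl | ht
    · rw [ρ0, add_zero]; rfl
    rw [ρs _ hs, ρs _ ht, ρs _ (by linarith)]
    exact smul' s hs t ht
  have ρan : AnalyticOnNhd ℝ ρ (Set.Ioi 0) := by
    intro t ht
    refine (san t ht).congr ?_
    filter_upwards [Ioi_mem_nhds ht] with s hs
    exact (ρs s hs).symm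
  refine ⟨ρ, ⟨ρc, ρmul, ?_, ρ0⟩, ?_, ?_, ρan, ?_⟩
  · intro t ht
    rcases ht.eq_or_lt with rfl | ht
    · rw [ρ0]; exact IsSelfAdjoint.one _
    · rw [ρs t ht]; exact ssa t ht
  · rintro ρ' ⟨h1, h2, -, -⟩ t ht
    have h4 : c < 4 * c := by linarith
    refine cancel (4 * c) h4 _ _ ?_
    conv_lhs => rw [← h1 _ h4, ← h2 t ht _ (by linarith), h1 _ (by linarith [ht])]
    rw [← ρc _ h4, ← ρmul t ht _ (by linarith), ρc _ (by linarith [ht])]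
  · intro v
    exact ρan.continuousOn.clm_apply continuousOn_const
  · intro t ht
    have h := pdense (t + 4 * c) (by linarith)
    rw [← ρc _ (by linarith), ρmul t ht _ (by linarith)] at h
    refine h.mono ?_
    rintro _ ⟨y, rfl⟩
    exact ⟨ρ (4 * c) y, rfl⟩
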